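/- Let p be a large prime and d ≥ 2 an even integer. For all real s with 2 ≤ s ≤ (log p)/(log log log p): Σ over integers j with s/π < |j| ≤ (log p)² of α_d( 2s/(π(2j+1)) ) = (2s/π)·∫₀¹ α_d(u)/u² du + O(1), with an absolute implied constant. -/

import Mathlib

open scoped BigOperators Classical

noncomputable section

/-- `α_d(u) = log((1/d) ∑_{k=0}^{d-1} exp(u cos(2kπ/d)))`. -/
def alphad (d : ℕ) (u : ℝ) : ℝ :=
  Real.log ((1 / d : ℝ) * ∑ k ∈ Finset.range d, Real.exp (u * Real.cos (2 * k * Real.pi / d)))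

/-- For even `d`, the average of exponentials in `alphad` is an average of hyperbolic cosines. -/
theorem alphad_add_self_eq_log_cosh {m : ℕ} (hm : 0 < m) (u : ℝ) :
    alphad (m + m) u = Real.log ((1 / m : ℝ) *
      ∑ k ∈ Finset.range m, Real.cosh (u * Real.cos (2 * k * Real.pi / ((m + m : ℕ) : ℝ)))) := by
  have hm' : (m : ℝ) ≠ 0 := by positivity
  unfold alphad
  rw [Finset.sum_range_add, ← Finset.sum_add_distrib]
  congr 1
  have h (k : ℕ) : Real.exp (u * Real.cos (2 * k * Real.pi / ((m + m : ℕ) : ℝ))) +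
      Real.exp (u * Real.cos (2 * ((m + k : ℕ) : ℝ) * Real.pi / ((m + m : ℕ) : ℝ))) =
      2 * Real.cosh (u * Real.cos (2 * k * Real.pi / ((m + m : ℕ) : ℝ))) := by
    have e : 2 * ((m + k : ℕ) : ℝ) * Real.pi / ((m + m : ℕ) : ℝ) =
        2 * k * Real.pi / ((m + m : ℕ) : ℝ) + Real.pi := by
      push_cast
      field_simp
      ring
    rw [e, Real.cos_add_pi, Real.cosh_eq, mul_neg]
    ring
  rw [Finset.sum_congr rfl fun k _ => h k, ← Finset.mul_sum, ← mul_assoc]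
  congr 1
  push_cast
  field_simp
  ring

theorem one_le_average_cosh {m : ℕ} (hm : 0 < m) (a : ℕ → ℝ) :
    1 ≤ (1 / m : ℝ) * ∑ k ∈ Finset.range m, Real.cosh (a k) := by
  have hm' : (0 : ℝ) < m := by positivity
  have h : ∑ k ∈ Finset.range m, (1 : ℝ) ≤ ∑ k ∈ Finset.range m, Real.cosh (a k) :=
    Finset.sum_le_sum fun k _ => Real.one_le_cosh _
  simp only [Finset.sum_const, Finset.card_range, nsmul_eq_mul, mul_one] at h
  rw [one_div, inv_mul_eq_div, le_div_iff₀ hm']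
  linarith

theorem alphad_nonneg {d : ℕ} (hd : 2 ≤ d) (he : Even d) (u : ℝ) : 0 ≤ alphad d u := by
  obtain ⟨m, rfl⟩ := he
  rw [alphad_add_self_eq_log_cosh (by omega)]
  exact Real.log_nonneg (one_le_average_cosh (by omega) _)

theorem alphad_neg {d : ℕ} (hd : 2 ≤ d) (he : Even d) (u : ℝ) :
    alphad d (-u) = alphad d u := by
  obtain ⟨m, rfl⟩ := he
  simp only [alphad_add_self_eq_log_cosh (show 0 < m by omega), neg_mul, Real.cosh_neg]

theorem alphad_monotoneOn {d : ℕ} (hd : 2 ≤ d) (he : Even d) :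
    MonotoneOn (alphad d) (Set.Ici 0) := by
  obtain ⟨m, rfl⟩ := he
  intro u hu v hv huv
  simp only [Set.mem_Ici] at hu hv
  simp only [alphad_add_self_eq_log_cosh (show 0 < m by omega)]
  refine Real.log_le_log (zero_lt_one.trans_le (one_le_average_cosh (by omega) _)) ?_
  gcongr 1 / (m : ℝ) * ?_
  refine Finset.sum_le_sum fun k _ => Real.cosh_le_cosh.2 ?_
  rw [abs_mul, abs_mul, abs_of_nonneg hu, abs_of_nonneg hv]
  gcongr

theorem alphad_le_half_sq {d : ℕ} (hd : 2 ≤ d) (he : Even d) (u : ℝ) :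
    alphad d u ≤ u ^ 2 / 2 := by
  obtain ⟨m, rfl⟩ := he
  have hm : (0 : ℝ) < m := by exact_mod_cast (show 0 < m by omega)
  rw [alphad_add_self_eq_log_cosh (by omega)]
  refine (Real.log_le_iff_le_exp
    (zero_lt_one.trans_le (one_le_average_cosh (by omega) _))).2 ?_
  rw [one_div, inv_mul_eq_div, div_le_iff₀ hm]
  have h (k : ℕ) : Real.cosh (u * Real.cos (2 * k * Real.pi / ((m + m : ℕ) : ℝ))) ≤
      Real.exp (u ^ 2 / 2) := by
    refine (Real.cosh_le_exp_half_sq _).trans (Real.exp_le_exp.2 ?_)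
    rw [mul_pow]
    nlinarith [Real.cos_sq_le_one (2 * k * Real.pi / ((m + m : ℕ) : ℝ)), sq_nonneg u]
  refine (Finset.sum_le_sum fun k _ => h k).trans_eq ?_
  simp [mul_comm]

theorem continuous_alphad {d : ℕ} (hd : 2 ≤ d) : Continuous (alphad d) := by
  have hd' : (0 : ℝ) < d := by positivity
  refine Continuous.log (by fun_prop) fun u => ne_of_gt (mul_pos (by positivity) ?_)
  exact Finset.sum_pos (fun _ _ => Real.exp_pos _) ⟨0, Finset.mem_range.2 (by omega)⟩

section Comparison

variable {A : ℝ → ℝ} {c : ℝ}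

theorem div_sq_intervalIntegrable (hA : Continuous A) (h0 : ∀ u, 0 ≤ A u)
    (h2 : ∀ u, A u ≤ u ^ 2 / 2) (a b : ℝ) :
    IntervalIntegrable (fun u => A u / u ^ 2) MeasureTheory.volume a b := by
  refine (intervalIntegrable_const (c := (1 / 2 : ℝ))).mono_fun
    ((hA.measurable.div (measurable_id.pow_const 2)).aestronglyMeasurable)
    (Filter.Eventually.of_forall fun u => ?_)
  have : 0 ≤ A u / u ^ 2 := div_nonneg (h0 u) (sq_nonneg u)
  beta_reduce
  rw [Real.norm_eq_abs, abs_of_nonneg this, Real.norm_eq_abs, abs_of_pos (by norm_num)]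
  rcases eq_or_ne u 0 with rfl | hu
  · simp
  · rw [div_le_iff₀ (by positivity)]
    linarith [h2 u]

/-- The tail `∫_x^∞ A (c / t) dt`, written in the variable `u = c / t`. -/
def tailIntegral (A : ℝ → ℝ) (c x : ℝ) : ℝ :=
  c * ∫ u in (0 : ℝ)..c / x, A u / u ^ 2

theorem tailIntegral_nonneg (h0 : ∀ u, 0 ≤ A u) (hc : 0 < c) {x : ℝ} (hx : 0 < x) :
    0 ≤ tailIntegral A c x :=
  mul_nonneg hc.le (intervalIntegral.integral_nonneg (by positivity)
    fun u _ => div_nonneg (h0 u) (sq_nonneg u))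

theorem tailIntegral_le (hA : Continuous A) (h0 : ∀ u, 0 ≤ A u)
    (h2 : ∀ u, A u ≤ u ^ 2 / 2) (hc : 0 < c) {x : ℝ} (hx : 0 < x) :
    tailIntegral A c x ≤ c ^ 2 / (2 * x) := by
  have h : ∫ u in (0 : ℝ)..c / x, A u / u ^ 2 ≤ ∫ _u in (0 : ℝ)..c / x, (1 / 2 : ℝ) := by
    refine intervalIntegral.integral_mono_on (by positivity)
      (div_sq_intervalIntegrable hA h0 h2 _ _) intervalIntegrable_const fun u _ => ?_
    rcases eq_or_ne u 0 with rfl | hu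
    · simp
    · rw [div_le_iff₀ (by positivity)]
      linarith [h2 u]
  calc tailIntegral A c x ≤ c * ∫ _u in (0 : ℝ)..c / x, (1 / 2 : ℝ) :=
        mul_le_mul_of_nonneg_left h hc.le
    _ = c ^ 2 / (2 * x) := by
        rw [intervalIntegral.integral_const, smul_eq_mul]
        field_simp
        ring

theorem tailIntegral_sub (hA : Continuous A) (h0 : ∀ u, 0 ≤ A u)
    (h2 : ∀ u, A u ≤ u ^ 2 / 2) (x y : ℝ) :
    tailIntegral A c x - tailIntegral A c y = c * ∫ u in c / y..c / x, A u / u ^ 2 := by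
  rw [tailIntegral, tailIntegral, ← mul_sub, intervalIntegral.integral_interval_sub_left
    (div_sq_intervalIntegrable hA h0 h2 _ _) (div_sq_intervalIntegrable hA h0 h2 _ _)]

theorem intervalIntegrable_const_div_sq (hc : 0 < c) (K : ℝ) {x y : ℝ} (hx : 0 < x)
    (hy : 0 < y) :
    IntervalIntegrable (fun u => K / u ^ 2) MeasureTheory.volume (c / y) (c / x) := by
  refine ContinuousOn.intervalIntegrable fun u hu => ContinuousAt.continuousWithinAt ?_
  have : 0 < u := (lt_min (by positivity) (by positivity)).trans_le hu.1
  have : u ^ 2 ≠ 0 := by positivity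
  fun_prop (disch := assumption)

theorem mul_integral_const_div_sq (hc : 0 < c) (K : ℝ) {x y : ℝ} (hx : 0 < x) (hy : 0 < y) :
    c * ∫ u in c / y..c / x, K / u ^ 2 = (y - x) * K := by
  have h : ∫ u in c / y..c / x, K / u ^ 2 = -K / (c / x) - -K / (c / y) := by
    refine intervalIntegral.integral_eq_sub_of_hasDerivAt (f := fun u => -K / u) (fun u hu => ?_)
      (intervalIntegrable_const_div_sq hc K hx hy)
    have hu0 : 0 < u := (lt_min (by positivity) (by positivity)).trans_le hu.1
    exact ((hasDerivAt_const u (-K)).fun_div (hasDerivAt_id' u) hu0.ne').congr_deriv (by simp)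
  rw [h]
  field_simp
  ring

theorem tailIntegral_sub_le (hA : Continuous A) (hmono : MonotoneOn A (Set.Ici 0))
    (h0 : ∀ u, 0 ≤ A u) (h2 : ∀ u, A u ≤ u ^ 2 / 2) (hc : 0 < c) {x y : ℝ} (hx : 0 < x)
    (hxy : x ≤ y) :
    tailIntegral A c x - tailIntegral A c y ≤ (y - x) * A (c / x) := by
  have hy := hx.trans_le hxy
  rw [tailIntegral_sub hA h0 h2, ← mul_integral_const_div_sq hc _ hx hy]
  refine mul_le_mul_of_nonneg_left (intervalIntegral.integral_mono_on (by gcongr)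
    (div_sq_intervalIntegrable hA h0 h2 _ _) (intervalIntegrable_const_div_sq hc _ hx hy)
    fun u hu => ?_) hc.le
  have hu0 : 0 < u := lt_of_lt_of_le (by positivity) hu.1
  gcongr
  exact hmono hu0.le (by simp only [Set.mem_Ici]; positivity) hu.2

theorem le_tailIntegral_sub (hA : Continuous A) (hmono : MonotoneOn A (Set.Ici 0))
    (h0 : ∀ u, 0 ≤ A u) (h2 : ∀ u, A u ≤ u ^ 2 / 2) (hc : 0 < c) {x y : ℝ} (hx : 0 < x)
    (hxy : x ≤ y) :
    (y - x) * A (c / y) ≤ tailIntegral A c x - tailIntegral A c y := by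
  have hy := hx.trans_le hxy
  rw [tailIntegral_sub hA h0 h2, ← mul_integral_const_div_sq hc _ hx hy]
  refine mul_le_mul_of_nonneg_left (intervalIntegral.integral_mono_on (by gcongr)
    (intervalIntegrable_const_div_sq hc _ hx hy) (div_sq_intervalIntegrable hA h0 h2 _ _)
    fun u hu => ?_) hc.le
  have hu0 : 0 < u := lt_of_lt_of_le (by positivity) hu.1
  gcongr
  exact hmono (by simp only [Set.mem_Ici]; positivity) hu0.le hu.1

theorem tailIntegral_sub_le_sum (hA : Continuous A) (hmono : MonotoneOn A (Set.Ici 0))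
    (h0 : ∀ u, 0 ≤ A u) (h2 : ∀ u, A u ≤ u ^ 2 / 2) (hc : 0 < c) {x : ℝ} (hx : 0 < x) (n : ℕ) :
    tailIntegral A c x - tailIntegral A c (x + n) ≤
      ∑ i ∈ Finset.range n, A (c / (x + i)) := by
  induction n with
  | zero => simp
  | succ n ih =>
    have := tailIntegral_sub_le hA hmono h0 h2 hc (x := x + n) (y := x + (n + 1 : ℕ))
      (by positivity) (by push_cast; linarith)
    rw [Finset.sum_range_succ]
    push_cast at this ⊢
    linarith

theorem sum_le_add_tailIntegral_sub (hA : Continuous A) (hmono : MonotoneOn A (Set.Ici 0))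
    (h0 : ∀ u, 0 ≤ A u) (h2 : ∀ u, A u ≤ u ^ 2 / 2) (hc : 0 < c) {x : ℝ} (hx : 0 < x) (n : ℕ) :
    ∑ i ∈ Finset.range (n + 1), A (c / (x + i)) ≤
      A (c / x) + (tailIntegral A c x - tailIntegral A c (x + n)) := by
  induction n with
  | zero => simp
  | succ n ih =>
    have := le_tailIntegral_sub hA hmono h0 h2 hc (x := x + n) (y := x + (n + 1 : ℕ))
      (by positivity) (by push_cast; linarith)
    rw [Finset.sum_range_succ]
    push_cast at this ih ⊢
    linarith

theorem abs_tailIntegral_sub_self_le (hA : Continuous A) (hmono : MonotoneOn A (Set.Ici 0))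
    (h0 : ∀ u, 0 ≤ A u) (h2 : ∀ u, A u ≤ u ^ 2 / 2) (hc : 0 < c) {x : ℝ} (hx : c / 2 ≤ x)
    (hxc : |x - c| ≤ 3 / 2) :
    |tailIntegral A c x - tailIntegral A c c| ≤ 3 := by
  have hx0 : 0 < x := lt_of_lt_of_le (by positivity) hx
  have hb {y : ℝ} (hy : c / 2 ≤ y) : A (c / y) ≤ 2 := by
    have hy0 : 0 < y := lt_of_lt_of_le (by positivity) hy
    have : c / y ≤ 2 := by rw [div_le_iff₀ hy0]; linarith
    have := h2 (c / y)
    nlinarith [div_pos hc hy0]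
  obtain ⟨h3, h4⟩ := abs_le.1 hxc
  rcases le_total x c with h | h
  · have hl := le_tailIntegral_sub hA hmono h0 h2 hc hx0 h
    have hu := tailIntegral_sub_le hA hmono h0 h2 hc hx0 h
    rw [abs_le]
    constructor
    · nlinarith [h0 (c / c)]
    · nlinarith [h0 (c / x), hb hx]
  · have hl := le_tailIntegral_sub hA hmono h0 h2 hc hc h
    have hu := tailIntegral_sub_le hA hmono h0 h2 hc hc h
    rw [abs_le]
    constructor
    · nlinarith [h0 (c / c), hb (y := c) (by linarith)]
    · nlinarith [h0 (c / x)]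

theorem abs_sum_sub_tailIntegral_le (hA : Continuous A) (hmono : MonotoneOn A (Set.Ici 0))
    (h0 : ∀ u, 0 ≤ A u) (h2 : ∀ u, A u ≤ u ^ 2 / 2) (hc : 0 < c) {x : ℝ} (hx : c / 2 ≤ x)
    (hxc : |x - c| ≤ 3 / 2) {n : ℕ} (hn : c ^ 2 ≤ x + (n + 1 : ℕ)) :
    |∑ i ∈ Finset.range (n + 1), A (c / (x + i)) - tailIntegral A c c| ≤ 5 := by
  have hx0 : 0 < x := lt_of_lt_of_le (by positivity) hx
  have hd := abs_le.1 (abs_tailIntegral_sub_self_le hA hmono h0 h2 hc hx hxc)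
  have hl := tailIntegral_sub_le_sum hA hmono h0 h2 hc hx0 (n + 1)
  have hu := sum_le_add_tailIntegral_sub hA hmono h0 h2 hc hx0 n
  have hp := tailIntegral_nonneg h0 hc (x := x + n) (by positivity)
  have hq : tailIntegral A c (x + (n + 1 : ℕ)) ≤ 1 := by
    refine (tailIntegral_le hA h0 h2 hc (by positivity)).trans ?_
    rw [div_le_one (by positivity)]
    nlinarith [sq_nonneg c]
  have hb : A (c / x) ≤ 2 := by
    have : c / x ≤ 2 := by rw [div_le_iff₀ hx0]; linarith
    have := h2 (c / x)
    nlinarith [div_pos hc hx0]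
  rw [abs_le]
  constructor <;> linarith [hd.1, hd.2]

end Comparison

/-- A sum over the integers with `c < |j| ≤ N` splits into the positive and the negative ones. -/
theorem sum_filter_abs_eq {c N : ℝ} (hc : 0 ≤ c) (hN : 0 ≤ N) {n : ℕ}
    (hn : ⌊c⌋₊ + 1 + n = ⌊N⌋₊) (g : ℤ → ℝ) :
    ∑ j ∈ (Finset.Icc (-(⌈N⌉₊ : ℤ)) (⌈N⌉₊ : ℤ)).filter
        (fun j : ℤ => c < |(j : ℝ)| ∧ |(j : ℝ)| ≤ N), g j =
      ∑ i ∈ Finset.range (n + 1), g ((⌊c⌋₊ + 1 + i : ℕ) : ℤ) +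
      ∑ i ∈ Finset.range (n + 1), g (-((⌊c⌋₊ + 1 + i : ℕ) : ℤ)) := by
  have hT : (Finset.Icc (-(⌈N⌉₊ : ℤ)) (⌈N⌉₊ : ℤ)).filter
        (fun j : ℤ => c < |(j : ℝ)| ∧ |(j : ℝ)| ≤ N) =
      (Finset.range (n + 1)).image (fun i => ((⌊c⌋₊ + 1 + i : ℕ) : ℤ)) ∪
      (Finset.range (n + 1)).image (fun i => -((⌊c⌋₊ + 1 + i : ℕ) : ℤ)) := by
    ext j
    have hj : |(j : ℝ)| = (j.natAbs : ℝ) := by rw [Nat.cast_natAbs, Int.cast_abs]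
    have hle : ⌊N⌋₊ ≤ ⌈N⌉₊ := Nat.floor_le_ceil N
    simp only [Finset.mem_filter, Finset.mem_Icc, Finset.mem_union, Finset.mem_image,
      Finset.mem_range, hj, ← Nat.floor_lt hc, ← Nat.le_floor_iff hN]
    constructor
    · rintro ⟨-, h1, h2⟩
      rcases le_total 0 j with h | h
      · exact Or.inl ⟨j.natAbs - (⌊c⌋₊ + 1), by omega, by omega⟩
      · exact Or.inr ⟨j.natAbs - (⌊c⌋₊ + 1), by omega, by omega⟩
    · rintro (⟨i, hi, rfl⟩ | ⟨i, hi, rfl⟩) <;> omega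
  rw [hT, Finset.sum_union, Finset.sum_image, Finset.sum_image]
  · intro a _ b _ hab
    simp only at hab
    omega
  · intro a _ b _ hab
    simp only at hab
    omega
  · rw [Finset.disjoint_left]
    simp only [Finset.mem_image, Finset.mem_range, not_exists, not_and]
    rintro _ ⟨i, -, rfl⟩ k - h
    omega

/-- Lemma 5.6: for even `d ≥ 2`, large primes `p` and `2 ≤ s ≤ (log p)/(log log log p)`,
`∑_{s/π < |j| ≤ (log p)²} α_d(2s/(π(2j+1))) = (2s/π) ∫₀¹ α_d(u)/u² du + O(1)`,
with an absolute implied constant. -/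
theorem middle_sum_estimate :
    ∃ C > 0, ∃ p₀ : ℕ, ∀ p : ℕ, p.Prime → p₀ ≤ p →
      ∀ d : ℕ, 2 ≤ d → Even d →
      ∀ s : ℝ, 2 ≤ s → s ≤ Real.log p / Real.log (Real.log (Real.log p)) →
        |Finset.sum
            ((Finset.Icc (-(⌈(Real.log p) ^ 2⌉₊ : ℤ)) ((⌈(Real.log p) ^ 2⌉₊ : ℤ))).filter
              (fun j : ℤ => s / Real.pi < |(j : ℝ)| ∧ |(j : ℝ)| ≤ (Real.log p) ^ 2))
            (fun j : ℤ => alphad d (2 * s / (Real.pi * (2 * (j : ℝ) + 1))))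
          - 2 * s / Real.pi * ∫ u in (0:ℝ)..1, alphad d u / u ^ 2| ≤ C := by
  have hlog : Filter.Tendsto (fun p : ℕ => Real.log p) Filter.atTop Filter.atTop :=
    Real.tendsto_log_atTop.comp tendsto_natCast_atTop_atTop
  obtain ⟨p₀, hp₀⟩ := Filter.eventually_atTop.1 ((hlog.eventually_ge_atTop 2).and
    ((Real.tendsto_log_atTop.comp (Real.tendsto_log_atTop.comp hlog)).eventually_ge_atTop 1))
  refine ⟨10, by norm_num, p₀, fun p _ hp d hd he s hs hsp => ?_⟩
  obtain ⟨hL, hLLL⟩ := hp₀ p hp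
  simp only [Function.comp_apply] at hLLL
  have hsL : s ≤ Real.log p := hsp.trans (div_le_self (by linarith) hLLL)
  set L := Real.log p
  have hpi := Real.pi_gt_three
  set c := s / Real.pi with hcdef
  have hc : 0 < c := by positivity
  have hcL : c ≤ L / 3 := by
    rw [hcdef, div_le_div_iff₀ (by positivity) (by norm_num)]
    nlinarith
  have hM := Nat.lt_floor_add_one c
  have hM' := Nat.floor_le hc.le
  have hK := Nat.lt_floor_add_one (L ^ 2)
  obtain ⟨n, hn⟩ : ∃ n, ⌊c⌋₊ + 1 + n = ⌊L ^ 2⌋₊ := by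
    refine Nat.exists_eq_add_of_le (Nat.le_floor ?_) |>.imp fun _ h => h.symm
    push_cast
    nlinarith
  have hn' : (⌊c⌋₊ : ℝ) + 1 + n = (⌊L ^ 2⌋₊ : ℝ) := by exact_mod_cast hn
  rw [sum_filter_abs_eq hc.le (sq_nonneg L) hn]
  have hpos (i : ℕ) : alphad d (2 * s / (Real.pi * (2 * (((⌊c⌋₊ + 1 + i : ℕ) : ℤ) : ℝ) + 1))) =
      alphad d (c / (((⌊c⌋₊ : ℝ) + 3 / 2) + i)) := by
    congr 1
    rw [hcdef]
    push_cast
    field_simp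
    ring
  have hneg (i : ℕ) :
      alphad d (2 * s / (Real.pi * (2 * ((-((⌊c⌋₊ + 1 + i : ℕ) : ℤ) : ℤ) : ℝ) + 1))) =
      alphad d (c / (((⌊c⌋₊ : ℝ) + 1 / 2) + i)) := by
    rw [← alphad_neg hd he]
    congr 1
    have h1 : (⌊c⌋₊ : ℝ) + 1 / 2 + i ≠ 0 := by positivity
    have h2 : 2 * ((-((⌊c⌋₊ + 1 + i : ℕ) : ℤ) : ℤ) : ℝ) + 1 =
        -(2 * ((⌊c⌋₊ : ℝ) + 1 / 2 + i)) := by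
      push_cast
      ring
    rw [h2, mul_neg, div_neg, neg_neg, hcdef, div_div, mul_left_comm,
      mul_div_mul_left _ _ two_ne_zero]
  have hmain : 2 * s / Real.pi * ∫ u in (0:ℝ)..1, alphad d u / u ^ 2 =
      2 * tailIntegral (alphad d) c c := by
    rw [tailIntegral, div_self hc.ne', hcdef]
    ring
  simp only [hpos, hneg, hmain]
  have hc2 : c ^ 2 ≤ L ^ 2 / 9 := by nlinarith
  have hfloor : (0 : ℝ) ≤ ⌊c⌋₊ := by positivity
  have e1 := abs_sum_sub_tailIntegral_le (continuous_alphad hd) (alphad_monotoneOn hd he)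
    (alphad_nonneg hd he) (alphad_le_half_sq hd he) hc (x := (⌊c⌋₊ : ℝ) + 3 / 2) (n := n)
    (by linarith) (by rw [abs_le]; constructor <;> linarith) (by push_cast; nlinarith)
  have e2 := abs_sum_sub_tailIntegral_le (continuous_alphad hd) (alphad_monotoneOn hd he)
    (alphad_nonneg hd he) (alphad_le_half_sq hd he) hc (x := (⌊c⌋₊ : ℝ) + 1 / 2) (n := n)
    (by linarith) (by rw [abs_le]; constructor <;> linarith) (by push_cast; nlinarith)
  rw [abs_le] at e1 e2 ⊢
  constructor <;> linarith [e1.1, e1.2, e2.1, e2.2]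

end
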